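/- arXiv:1801.09618 — 4 statements merged into one kernel-verified Lean document; each statement's English description precedes it below -/
import Mathlib

section
/- Let G be a parity game with priorities in {1,…,p} where p > 1 is odd, let V_p be its set of vertices of priority p, and let Win, Lose ⊆ V be disjoint sets with V_p ∩ (Win ∪ Lose) = ∅. Then W_E(O(Win, Lose)) is the least fixed point of the monotone operator on subsets of V given by X ↦ W_E(O(Win ∪ (V_p ∩ Pre(X)), Lose ∪ (V_p ∖ Pre(X)))). -/
/-- A parity game: a finite directed graph in which every vertex has at least one
outgoing edge, a partition of vertices between Eve (`EveV`) and Adam (the complement),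
and a priority function `c : V → {1, …, d}`. -/
structure ParityGame where
  V : Type
  [fintypeV : Fintype V]
  E : V → V → Prop
  exists_succ : ∀ v, ∃ w, E v w
  EveV : Set V
  d : ℕ
  c : V → ℕ
  c_pos : ∀ v, 1 ≤ c v
  c_le_d : ∀ v, c v ≤ d

attribute [instance] ParityGame.fintypeV

namespace ParityGame

variable (G : ParityGame)

/-- A play from `v0`: an infinite sequence of vertices starting at `v0` and following edges. -/
def IsPlay (v0 : G.V) (π : ℕ → G.V) : Prop :=
  π 0 = v0 ∧ ∀ i, G.E (π i) (π (i + 1))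

/-- The parity objective: the largest priority occurring infinitely often is even. -/
def SatParity (π : ℕ → G.V) : Prop :=
  Even (sSup {p | ∀ N, ∃ i, N ≤ i ∧ G.c (π i) = p})

/-- A strategy for Eve: maps a (finite) history together with the current vertex
(so together: a finite nonempty sequence of vertices ending in a vertex of `EveV`)
to a next vertex, always following an edge. -/
structure EveStrategy (G : ParityGame) where
  move : List G.V → G.V → G.V
  follows : ∀ l v, v ∈ G.EveV → G.E v (move l v)

/-- A play is consistent with Eve's strategy `σ` if whenever `π i ∈ EveV`,
the next vertex is the one prescribed by `σ` applied to `π₀ … π_i`. -/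
def ConsistentE (σ : EveStrategy G) (π : ℕ → G.V) : Prop :=
  ∀ i, π i ∈ G.EveV → π (i + 1) = σ.move ((List.range i).map π) (π i)

/-- Eve wins the objective `Ω` from `v0`. -/
def EveWinsObj (Ω : (ℕ → G.V) → Prop) (v0 : G.V) : Prop :=
  ∃ σ : EveStrategy G, ∀ π, G.IsPlay v0 π → G.ConsistentE σ π → Ω π

/-- Eve wins (the parity objective) from `v0`. -/
def EveWinsFrom (v0 : G.V) : Prop :=
  G.EveWinsObj G.SatParity v0

end ParityGame

namespace ParityGame

variable (G : ParityGame)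

/-- The objective `O(W, L)` for disjoint `W, L`: either reach `W` without having visited `L`
before, or never visit `W ∪ L` and satisfy the parity objective. -/
def Obj (W L : Set G.V) (π : ℕ → G.V) : Prop :=
  (∃ i, π i ∈ W ∧ ∀ j < i, π j ∉ L) ∨ ((∀ i, π i ∉ W ∪ L) ∧ G.SatParity π)

/-- Eve's winning region for an objective `Ω`. -/
def WinRegion (Ω : (ℕ → G.V) → Prop) : Set G.V :=
  {v0 | G.EveWinsObj Ω v0}

/-- `Pre(Y)`: the vertices from which Eve can ensure to reach `Y` in one step. -/
def Pre (Y : Set G.V) : Set G.V :=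
  {u | (u ∈ G.EveV ∧ ∃ v, G.E u v ∧ v ∈ Y) ∨ (u ∉ G.EveV ∧ ∀ v, G.E u v → v ∈ Y)}

end ParityGame

namespace ParityGame

section Residual

variable {G : ParityGame}

/-- The residual strategy after the history `l`. -/
def EveStrategy.shift (σ : EveStrategy G) (l : List G.V) : EveStrategy G where
  move l' v := σ.move (l ++ l') v
  follows l' v hv := σ.follows (l ++ l') v hv

/-- The strategy `σ` wins the objective `Ω` from `v`. -/
def EveStrategy.Wins (σ : EveStrategy G) (Ω : (ℕ → G.V) → Prop) (v : G.V) : Prop :=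
  ∀ π, G.IsPlay v π → G.ConsistentE σ π → Ω π

theorem satParity_tail (π : ℕ → G.V) : G.SatParity (fun n => π (n + 1)) ↔ G.SatParity π := by
  have : {p | ∀ N, ∃ i, N ≤ i ∧ G.c (π (i + 1)) = p} = {p | ∀ N, ∃ i, N ≤ i ∧ G.c (π i) = p} := by
    ext p
    constructor
    · intro h N
      obtain ⟨i, hi, hc⟩ := h N
      exact ⟨i + 1, by omega, hc⟩
    · intro h N
      obtain ⟨i, hi, hc⟩ := h (N + 1)
      exact ⟨i - 1, by omega, by rwa [Nat.sub_add_cancel (by omega)]⟩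
  simp only [SatParity, this]

theorem obj_of_mem {W L : Set G.V} {π : ℕ → G.V} (h : π 0 ∈ W) : G.Obj W L π :=
  Or.inl ⟨0, h, by simp⟩

theorem not_obj_of_mem {W L : Set G.V} {π : ℕ → G.V} (hL : π 0 ∈ L) (hW : π 0 ∉ W) :
    ¬ G.Obj W L π := by
  rintro (⟨i, hi, hj⟩ | ⟨h, -⟩)
  · rcases Nat.eq_zero_or_pos i with rfl | hpos
    · exact hW hi
    · exact hj 0 hpos hL
  · exact h 0 (Or.inr hL)

theorem obj_tail {W L : Set G.V} {π : ℕ → G.V} (h : π 0 ∉ W ∪ L) :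
    G.Obj W L (fun n => π (n + 1)) ↔ G.Obj W L π := by
  have hW : π 0 ∉ W := fun h' => h (Or.inl h')
  have hL : π 0 ∉ L := fun h' => h (Or.inr h')
  unfold Obj
  rw [satParity_tail]
  refine or_congr ⟨?_, ?_⟩ (and_congr_left fun _ => ⟨?_, fun h' i => h' (i + 1)⟩)
  · rintro ⟨i, hi, hj⟩
    refine ⟨i + 1, hi, fun j hji => ?_⟩
    cases j with
    | zero => exact hL
    | succ j => exact hj j (by omega)
  · rintro ⟨i, hi, hj⟩
    cases i with
    | zero => exact absurd hi hW
    | succ i => exact ⟨i, hi, fun j hji => hj (j + 1) (by omega)⟩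
  · intro h' i
    cases i with
    | zero => exact h
    | succ i => exact h' i

theorem consistentE_iff_tail {σ : EveStrategy G} {π : ℕ → G.V} :
    G.ConsistentE σ π ↔ (π 0 ∈ G.EveV → π 1 = σ.move [] (π 0)) ∧
      G.ConsistentE (σ.shift [π 0]) (fun n => π (n + 1)) := by
  have key : ∀ i, (List.range (i + 1)).map π =
      [π 0] ++ (List.range i).map (fun n => π (n + 1)) := by
    intro i
    simp [List.range_succ_eq_map, Function.comp_def]
  constructor
  · intro h
    refine ⟨fun h0 => h 0 h0, fun i hi => ?_⟩
    have := h (i + 1) hi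
    rwa [key] at this
  · rintro ⟨h0, h⟩ i hi
    cases i with
    | zero => exact h0 hi
    | succ i =>
      rw [key]
      exact h i hi

theorem IsPlay.tail {v : G.V} {π : ℕ → G.V} (h : G.IsPlay v π) :
    G.IsPlay (π 1) (fun n => π (n + 1)) :=
  ⟨rfl, fun i => h.2 (i + 1)⟩

theorem EveStrategy.Wins.shift {σ : EveStrategy G} {W L : Set G.V} {v w : G.V}
    (hσ : σ.Wins (G.Obj W L) v) (hv : v ∉ W ∪ L) (hE : G.E v w)
    (hw : v ∈ G.EveV → w = σ.move [] v) : (σ.shift [v]).Wins (G.Obj W L) w := by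
  intro π hπ hc
  let ρ : ℕ → G.V := fun n => Nat.casesOn n v π
  refine (obj_tail (π := ρ) hv).2 (hσ ρ ⟨rfl, fun i => ?_⟩ ?_)
  · cases i with
    | zero => simpa [ρ, hπ.1] using hE
    | succ i => exact hπ.2 i
  · exact consistentE_iff_tail.2 ⟨fun h => hπ.1.trans (hw h), hc⟩

theorem winRegion_subset_pre {W L : Set G.V} {v : G.V} (h : v ∈ G.WinRegion (G.Obj W L))
    (hv : v ∉ W ∪ L) : v ∈ G.Pre (G.WinRegion (G.Obj W L)) := by
  obtain ⟨σ, hσ⟩ := h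
  by_cases he : v ∈ G.EveV
  · exact Or.inl ⟨he, σ.move [] v, σ.follows _ _ he, σ.shift [v],
      EveStrategy.Wins.shift hσ hv (σ.follows _ _ he) fun _ => rfl⟩
  · exact Or.inr ⟨he, fun w hw => ⟨σ.shift [v],
      EveStrategy.Wins.shift hσ hv hw fun h => absurd h he⟩⟩

theorem mem_winRegion_of_consistent {W L : Set G.V} (k : ℕ) {σ : EveStrategy G} {π : ℕ → G.V}
    (hσ : σ.Wins (G.Obj W L) (π 0)) (hπ : G.IsPlay (π 0) π) (hc : G.ConsistentE σ π)
    (h : ∀ i < k, π i ∉ W ∪ L) : π k ∈ G.WinRegion (G.Obj W L) := by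
  induction k generalizing σ π with
  | zero => exact ⟨σ, hσ⟩
  | succ k ih =>
    obtain ⟨h0, hc'⟩ := consistentE_iff_tail.1 hc
    exact ih (hσ.shift (h 0 (by omega)) (hπ.2 0) h0) hπ.tail hc' fun i hi => h (i + 1) (by omega)

theorem history_eq_map_range {α : Type*} {h : ℕ → List α} {ρ : ℕ → α} (h0 : h 0 = [])
    (hs : ∀ n, h (n + 1) = h n ++ [ρ n]) (n : ℕ) : h n = (List.range n).map ρ := by
  induction n with
  | zero => simp [h0]
  | succ n ih => simp [hs, ih, List.range_succ]

theorem exists_consistent_play (σ : EveStrategy G) (v : G.V) :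
    ∃ π, G.IsPlay v π ∧ G.ConsistentE σ π := by
  classical
  choose f hf using G.exists_succ
  let s : ℕ → List G.V × G.V := fun n => Nat.rec ([], v)
    (fun _ x => (x.1 ++ [x.2], if x.2 ∈ G.EveV then σ.move x.1 x.2 else f x.2)) n
  have hl := history_eq_map_range (h := fun n => (s n).1) (ρ := fun n => (s n).2) rfl fun _ => rfl
  have hs : ∀ i, (s (i + 1)).2 =
      if (s i).2 ∈ G.EveV then σ.move (s i).1 (s i).2 else f (s i).2 := fun _ => rfl
  refine ⟨fun n => (s n).2, ⟨rfl, fun i => ?_⟩, fun i hi => ?_⟩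
  · simp only [hs]
    split_ifs with he
    · exact σ.follows _ _ he
    · exact hf _
  · simp only [← hl, hs]
    exact if_pos hi

end Residual

section Compose

variable {G : ParityGame}

open Classical in
/-- Follow `σ` until `T` is visited, then move by `f` and play the strategy `S` attached to the
vertex reached. -/
noncomputable def switchMove (T : Set G.V) (f : G.V → G.V) (S : G.V → EveStrategy G) :
    List G.V → EveStrategy G → G.V → G.V
  | [], σ, u => if u ∈ T then f u else σ.move [] u
  | a :: l, σ, u =>
    if a ∈ T then (S (l.headD u)).move l u else switchMove T f S l (σ.shift [a]) u

/-- The strategy given by `switchMove`. -/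
noncomputable def EveStrategy.switch (σ : EveStrategy G) (T : Set G.V) (f : G.V → G.V)
    (S : G.V → EveStrategy G) (hf : ∀ u ∈ G.EveV, G.E u (f u)) : EveStrategy G where
  move l u := switchMove T f S l σ u
  follows l u hu := by
    induction l generalizing σ with
    | nil =>
      unfold switchMove
      split_ifs
      · exact hf u hu
      · exact σ.follows _ _ hu
    | cons a l ih =>
      unfold switchMove
      split_ifs
      · exact (S _).follows _ _ hu
      · exact ih _

variable {T : Set G.V} {f : G.V → G.V} {S : G.V → EveStrategy G}
  {hf : ∀ u ∈ G.EveV, G.E u (f u)}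

theorem EveStrategy.shift_switch {σ : EveStrategy G} {v : G.V} (hv : v ∉ T) :
    (σ.switch T f S hf).shift [v] = (σ.shift [v]).switch T f S hf := by
  simp [EveStrategy.shift, EveStrategy.switch, switchMove, hv]

theorem consistentE_of_switch {σ : EveStrategy G} {π : ℕ → G.V} (hT : ∀ i, π i ∉ T)
    (hc : G.ConsistentE (σ.switch T f S hf) π) : G.ConsistentE σ π := by
  have key : ∀ (l : List G.V) (τ : EveStrategy G) (u : G.V), (∀ a ∈ l, a ∉ T) → u ∉ T →
      switchMove T f S l τ u = τ.move l u := by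
    intro l
    induction l with
    | nil => intro τ u _ hu; simp [switchMove, hu]
    | cons a l ih =>
      intro τ u hl hu
      rw [switchMove, if_neg (hl a (by simp)), ih _ _ (fun b hb => hl b (by simp [hb])) hu]
      rfl
  intro i hi
  rw [hc i hi]
  exact key _ _ _ (by simpa using fun a _ => hT a) (hT i)

theorem consistentE_tail_of_switch {σ : EveStrategy G} {π : ℕ → G.V} (hT : π 0 ∈ T)
    (hc : G.ConsistentE (σ.switch T f S hf) π) :
    G.ConsistentE (S (π 1)) (fun n => π (n + 1)) := by
  intro i hi
  rw [(consistentE_iff_tail.1 hc).2 i hi]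
  have : ((List.range i).map fun n => π (n + 1)).headD (π (i + 1)) = π 1 := by
    cases i <;> simp [List.range_succ_eq_map]
  simp only [EveStrategy.shift, EveStrategy.switch, List.singleton_append, switchMove, if_pos hT,
    this]

/-- If Eve wins the game in which visiting `T` counts as a win and visiting `R` as a loss, and
she can step from `T` into her winning region, then she wins. -/
theorem winRegion_union_subset {W L T R : Set G.V} (hTW : Disjoint T (W ∪ L))
    (hT : T ⊆ G.Pre (G.WinRegion (G.Obj W L))) :
    G.WinRegion (G.Obj (W ∪ T) (L ∪ R)) ⊆ G.WinRegion (G.Obj W L) := by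
  classical
  set A := G.WinRegion (G.Obj W L)
  rintro v ⟨σ, hσ⟩
  have hf : ∀ u, ∃ w, G.E u w ∧ (u ∈ T → u ∈ G.EveV → w ∈ A) := by
    intro u
    by_cases hu : u ∈ T ∧ u ∈ G.EveV
    · rcases hT hu.1 with ⟨-, w, hw, hwA⟩ | ⟨hn, -⟩
      · exact ⟨w, hw, fun _ _ => hwA⟩
      · exact absurd hu.2 hn
    · obtain ⟨w, hw⟩ := G.exists_succ u
      exact ⟨w, hw, fun h1 h2 => absurd ⟨h1, h2⟩ hu⟩
  choose f hfE hfA using hf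
  have hS : ∀ u, ∃ τ : EveStrategy G, u ∈ A → τ.Wins (G.Obj W L) u := by
    intro u
    by_cases hu : u ∈ A
    · obtain ⟨τ, hτ⟩ := hu
      exact ⟨τ, fun _ => hτ⟩
    · exact ⟨σ, fun h => absurd h hu⟩
  choose S hS using hS
  have hreach : ∀ (j : ℕ) (σ : EveStrategy G) (π : ℕ → G.V), π j ∈ T → (∀ i < j, π i ∉ T) →
      σ.Wins (G.Obj (W ∪ T) (L ∪ R)) (π 0) → G.IsPlay (π 0) π →
      G.ConsistentE (σ.switch T f S fun u _ => hfE u) π → G.Obj W L π := by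
    intro j
    induction j with
    | zero =>
      intro σ π h0 _ _ hπ hc
      rw [← obj_tail (Set.disjoint_left.1 hTW h0)]
      refine hS (π 1) ?_ _ hπ.tail (consistentE_tail_of_switch h0 hc)
      by_cases he : π 0 ∈ G.EveV
      · have : π 1 = f (π 0) := by
          rw [(consistentE_iff_tail.1 hc).1 he]
          simp [EveStrategy.switch, switchMove, h0]
        rw [this]
        exact hfA _ h0 he
      · rcases hT h0 with ⟨h, -⟩ | ⟨-, h⟩
        · exact absurd h he
        · exact h _ (hπ.2 0)
    | succ j ih =>
      intro σ π hj hlt hσ hπ hc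
      have h0 : π 0 ∉ T := hlt 0 (by omega)
      by_cases hW : π 0 ∈ W
      · exact obj_of_mem hW
      have hW' : π 0 ∉ W ∪ T := by simp [hW, h0]
      have hL' : π 0 ∉ L ∪ R := by
        intro hL
        obtain ⟨ρ, hρ, hρc⟩ := exists_consistent_play σ (π 0)
        rw [← hρ.1] at hL hW'
        exact not_obj_of_mem hL hW' (hσ ρ hρ hρc)
      have hL : π 0 ∉ L := fun h => hL' (Or.inl h)
      obtain ⟨hc0, hc1⟩ := consistentE_iff_tail.1 hc
      rw [EveStrategy.shift_switch h0] at hc1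
      rw [← obj_tail (by simp [hW, hL])]
      refine ih (σ.shift [π 0]) _ hj (fun i hi => hlt (i + 1) (by omega)) ?_ hπ.tail hc1
      refine hσ.shift (fun h => h.elim hW' hL') (hπ.2 0) fun he => ?_
      rw [hc0 he]
      simp [EveStrategy.switch, switchMove, h0]
  refine ⟨σ.switch T f S fun u _ => hfE u, fun π hπ hc => ?_⟩
  by_cases h : ∃ j, π j ∈ T
  · have hv := hπ.1
    subst hv
    exact hreach (Nat.find h) σ π (Nat.find_spec h) (fun i hi => Nat.find_min h hi) hσ hπ hc
  · push Not at h
    rcases hσ π hπ (consistentE_of_switch h hc) with ⟨i, hi, hj⟩ | ⟨h1, h2⟩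
    · exact Or.inl ⟨i, hi.resolve_right (h i), fun j hji hL => hj j hji (Or.inl hL)⟩
    · exact Or.inr ⟨fun i hi => h1 i (hi.imp Or.inl Or.inl), h2⟩

end Compose

section Fixpoint

variable {G : ParityGame}

theorem winRegion_subset_winRegion_pre {W L P : Set G.V} (hWL : Disjoint W L)
    (hP : Disjoint P (W ∪ L)) :
    G.WinRegion (G.Obj W L) ⊆
      G.WinRegion (G.Obj (W ∪ (P ∩ G.Pre (G.WinRegion (G.Obj W L))))
        (L ∪ (P \ G.Pre (G.WinRegion (G.Obj W L))))) := by
  classical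
  rintro v ⟨σ, hσ⟩
  refine ⟨σ, fun π hπ hc => ?_⟩
  have hv := hπ.1
  subst hv
  by_cases h : ∃ j, π j ∈ W ∪ L ∪ P
  · have hmin : ∀ i < Nat.find h, π i ∉ W ∪ L ∪ P := fun i hi => Nat.find_min h hi
    have hL : ∀ i < Nat.find h, π i ∉ L ∪ (P \ G.Pre (G.WinRegion (G.Obj W L))) :=
      fun i hi hL => hmin i hi (hL.elim (fun h => Or.inl (Or.inr h)) fun h => Or.inr h.1)
    refine Or.inl ⟨Nat.find h, ?_, hL⟩
    rcases Nat.find_spec h with (hj | hj) | hj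
    · exact Or.inl hj
    · exfalso
      rcases hσ π hπ hc with ⟨i, hi, hlt⟩ | ⟨h1, -⟩
      · rcases lt_trichotomy i (Nat.find h) with hlt' | heq | hgt
        · exact hmin i hlt' (Or.inl (Or.inl hi))
        · exact Set.disjoint_left.1 hWL hi (heq ▸ hj)
        · exact hlt _ hgt hj
      · exact h1 _ (Or.inr hj)
    · exact Or.inr ⟨hj, winRegion_subset_pre (mem_winRegion_of_consistent _ hσ hπ hc
        fun i hi h' => hmin i hi (Or.inl h')) (Set.disjoint_left.1 hP hj)⟩
  · push Not at h
    rcases hσ π hπ hc with ⟨i, hi, -⟩ | ⟨-, h2⟩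
    · exact absurd (Or.inl (Or.inl hi)) (h i)
    · refine Or.inr ⟨fun i hi => h i ?_, h2⟩
      rcases hi with (hi | hi) | (hi | hi)
      · exact Or.inl (Or.inl hi)
      · exact Or.inr hi.1
      · exact Or.inl (Or.inr hi)
      · exact Or.inr hi.1

theorem not_satParity_of_odd {π : ℕ → G.V} (hp : Odd G.d) (h : ∀ N, ∃ i, N ≤ i ∧ G.c (π i) = G.d) :
    ¬ G.SatParity π := by
  have : sSup {p | ∀ N, ∃ i, N ≤ i ∧ G.c (π i) = p} = G.d := by
    refine IsGreatest.csSup_eq ⟨h, fun p hpm => ?_⟩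
    obtain ⟨i, -, rfl⟩ := hpm 0
    exact G.c_le_d _
  rw [SatParity, this, Nat.not_even_iff_odd]
  exact hp

/-- A prefixed point of the operator contains Eve's winning region: otherwise Adam can, against a
winning strategy, visit the maximal odd priority infinitely often. -/
theorem winRegion_subset_of_prefixed {W L X : Set G.V} (hp : Odd G.d) (hWL : Disjoint W L)
    (hX : G.WinRegion (G.Obj (W ∪ ({v : G.V | G.c v = G.d} ∩ G.Pre X))
      (L ∪ ({v : G.V | G.c v = G.d} \ G.Pre X))) ⊆ X) :
    G.WinRegion (G.Obj W L) ⊆ X := by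
  classical
  set P : Set G.V := {v | G.c v = G.d}
  set Ω := G.Obj (W ∪ (P ∩ G.Pre X)) (L ∪ (P \ G.Pre X))
  rintro v ⟨σ, hσ⟩
  by_contra hv
  let Inv : List G.V × (ℕ → G.V) → Prop := fun s =>
    (σ.shift s.1).Wins (G.Obj W L) (s.2 0) ∧ G.IsPlay (s.2 0) s.2 ∧
      G.ConsistentE (σ.shift s.1) s.2 ∧ ¬ Ω s.2
  have hplan : ∀ (l : List G.V) (w : G.V), (σ.shift l).Wins (G.Obj W L) w → w ∉ X →
      ∃ π, π 0 = w ∧ Inv (l, π) := by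
    intro l w hw hwX
    have : ¬ (σ.shift l).Wins Ω w := fun h => hwX (hX ⟨_, h⟩)
    simp only [EveStrategy.Wins, not_forall] at this
    obtain ⟨π, hπ, hc, hn⟩ := this
    have h0 := hπ.1
    subst h0
    exact ⟨π, rfl, hw, hπ, hc, hn⟩
  have havoid : ∀ s, Inv s → s.2 0 ∉ W ∪ L := by
    rintro ⟨l, π⟩ ⟨hw, hπ, hc, hn⟩ (h | h)
    · exact hn (obj_of_mem (Or.inl h))
    · exact not_obj_of_mem h (Set.disjoint_right.1 hWL h) (hw π hπ hc)
  have hstep : ∀ s, Inv s → ∃ t, Inv t ∧ t.1 = s.1 ++ [s.2 0] ∧ G.E (s.2 0) (t.2 0) ∧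
      (s.2 0 ∈ G.EveV → t.2 0 = σ.move s.1 (s.2 0)) ∧
      (s.2 0 ∉ P → t.2 = fun n => s.2 (n + 1)) := by
    rintro ⟨l, π⟩ hI
    have h0 := havoid _ hI
    obtain ⟨hw, hπ, hc, hn⟩ := hI
    have hshift : (σ.shift l).shift [π 0] = σ.shift (l ++ [π 0]) := by
      simp [EveStrategy.shift]
    by_cases hpv : π 0 ∈ P
    · have hpre : π 0 ∉ G.Pre X := fun h => hn (obj_of_mem (Or.inr ⟨hpv, h⟩))
      obtain ⟨w, hE, hm, hwX⟩ : ∃ w, G.E (π 0) w ∧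
          (π 0 ∈ G.EveV → w = σ.move l (π 0)) ∧ w ∉ X := by
        by_cases he : π 0 ∈ G.EveV
        · exact ⟨_, σ.follows l _ he, fun _ => rfl,
            fun h => hpre (Or.inl ⟨he, _, σ.follows l _ he, h⟩)⟩
        · by_contra! hcon
          exact hpre (Or.inr ⟨he, fun w hE => hcon w hE fun h => absurd h he⟩)
      have hw' := hw.shift h0 hE (by simpa [EveStrategy.shift] using hm)
      rw [hshift] at hw'
      obtain ⟨ρ, rfl, hI⟩ := hplan _ w hw' hwX
      exact ⟨(l ++ [π 0], ρ), hI, rfl, hE, hm, fun h => absurd hpv h⟩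
    · obtain ⟨hc0, hc1⟩ := consistentE_iff_tail.1 hc
      have hw' := hw.shift h0 (hπ.2 0) hc0
      rw [hshift] at hw' hc1
      refine ⟨(l ++ [π 0], fun n => π (n + 1)), ⟨hw', hπ.tail, hc1, fun h => hn ?_⟩, rfl,
        hπ.2 0, by simpa [EveStrategy.shift] using hc0, fun _ => rfl⟩
      refine (obj_tail ?_).1 h
      rintro ((h | h) | (h | h))
      · exact h0 (Or.inl h)
      · exact hpv h.1
      · exact h0 (Or.inr h)
      · exact hpv h.1
  obtain ⟨π₀, hπ₀, hI₀⟩ := hplan [] v hσ hv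
  choose! next hnI hnl hnE hnm hnt using hstep
  let s : ℕ → List G.V × (ℕ → G.V) := fun n => Nat.rec ([], π₀) (fun _ => next) n
  have hs : ∀ n, s (n + 1) = next (s n) := fun _ => rfl
  have hI : ∀ n, Inv (s n) := fun n => by
    induction n with
    | zero => exact hI₀
    | succ n ih => exact hnI _ ih
  let ρ : ℕ → G.V := fun n => (s n).2 0
  have hl : ∀ n, (s n).1 = (List.range n).map ρ :=
    history_eq_map_range rfl fun n => hnl _ (hI n)
  have hρ : G.Obj W L ρ := by
    refine hσ ρ ⟨hπ₀, fun i => hnE _ (hI i)⟩ fun i hi => ?_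
    rw [← hl]
    exact hnm _ (hI i) hi
  have hρav : ∀ n, ρ n ∉ W ∪ L := fun n => havoid _ (hI n)
  have hpar : G.SatParity ρ := by
    rcases hρ with ⟨i, hi, -⟩ | ⟨-, h⟩
    · exact absurd (Or.inl hi) (hρav i)
    · exact h
  refine not_satParity_of_odd hp (fun N => ?_) hpar
  by_contra! hcon
  have htail : ∀ k, (s (N + k)).2 = fun n => (s N).2 (n + k) := by
    intro k
    induction k with
    | zero => rfl
    | succ k ih =>
      rw [← add_assoc, hs, hnt _ (hI _) (hcon _ (by omega)), ih]
      funext n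
      simp only [add_assoc, add_comm 1 k]
  have hval : ∀ k, (s N).2 k = ρ (N + k) := fun k => by simp [ρ, htail]
  obtain ⟨hw, hπ, hc, hn⟩ := hI N
  rcases hw _ hπ hc with ⟨i, hi, -⟩ | ⟨h1, h2⟩
  · exact hρav (N + i) (Or.inl (hval i ▸ hi))
  · refine hn (Or.inr ⟨fun i hi => ?_, h2⟩)
    have hP' : (s N).2 i ∉ P := by
      rw [hval]
      exact hcon _ (by omega)
    rcases hi with (h | h) | (h | h)
    · exact h1 i (Or.inl h)
    · exact hP' h.1
    · exact h1 i (Or.inr h)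
    · exact hP' h.1

end Fixpoint

end ParityGame

/-- Let `G` be a parity game with priorities in `{1,…,p}` with `p > 1` odd,
`V_p` its set of vertices of priority `p`, and `Win, Lose ⊆ V` disjoint sets with
`V_p ∩ (Win ∪ Lose) = ∅`. Then `W_E(O(Win, Lose))` is the least fixed point of
`X ↦ W_E(O(Win ∪ (V_p ∩ Pre(X)), Lose ∪ (V_p ∖ Pre(X))))`. -/
theorem winRegion_least_fixed_point (G : ParityGame) (hp : Odd G.d) (hp1 : 1 < G.d)
    (Win Lose : Set G.V) (hdisj : Disjoint Win Lose)
    (hsep : {v : G.V | G.c v = G.d} ∩ (Win ∪ Lose) = ∅) :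
    (G.WinRegion (G.Obj
        (Win ∪ ({v : G.V | G.c v = G.d} ∩ G.Pre (G.WinRegion (G.Obj Win Lose))))
        (Lose ∪ ({v : G.V | G.c v = G.d} \ G.Pre (G.WinRegion (G.Obj Win Lose)))))
      = G.WinRegion (G.Obj Win Lose)) ∧
    ∀ X : Set G.V,
      G.WinRegion (G.Obj (Win ∪ ({v : G.V | G.c v = G.d} ∩ G.Pre X))
          (Lose ∪ ({v : G.V | G.c v = G.d} \ G.Pre X))) = X →
      G.WinRegion (G.Obj Win Lose) ⊆ X := by
  have hP := Set.disjoint_iff_inter_eq_empty.2 hsep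
  refine ⟨Set.Subset.antisymm ?_ (ParityGame.winRegion_subset_winRegion_pre hdisj hP),
    fun X hX => ParityGame.winRegion_subset_of_prefixed hp hdisj hX.subset⟩
  exact ParityGame.winRegion_union_subset (hP.mono_left Set.inter_subset_left)
    Set.inter_subset_right
end

section
/- Parity games are determined: for every parity game and every vertex v ∈ V, either Eve wins from v or Adam wins from v. -/
namespace ParityGame

/-- A strategy for Adam, defined symmetrically to Eve's strategies. -/
structure AdamStrategy (G : ParityGame) where
  move : List G.V → G.V → G.V
  follows : ∀ l v, v ∉ G.EveV → G.E v (move l v)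

/-- A play is consistent with Adam's strategy `τ` if whenever `π i` is Adam's,
the next vertex is the one prescribed by `τ` applied to `π₀ … π_i`. -/
def ConsistentA (G : ParityGame) (τ : AdamStrategy G) (π : ℕ → G.V) : Prop :=
  ∀ i, π i ∉ G.EveV → π (i + 1) = τ.move ((List.range i).map π) (π i)

/-- Adam wins from `v0` if he has a strategy all of whose consistent plays from `v0`
violate the parity objective. -/
def AdamWinsFrom (G : ParityGame) (v0 : G.V) : Prop :=
  ∃ τ : AdamStrategy G, ∀ π, G.IsPlay v0 π → G.ConsistentA τ π → ¬ G.SatParity π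

end ParityGame

namespace ParityGame

variable {G : ParityGame}

/-- The vertices controlled by a player: Eve is `true` and Adam is `false`. -/
def Owns (G : ParityGame) (b : Bool) (v : G.V) : Prop :=
  b = true ↔ v ∈ G.EveV

/-- The objective of a player. -/
def Objective (G : ParityGame) (b : Bool) (π : ℕ → G.V) : Prop :=
  b = true ↔ G.SatParity π

/-- The play `π` stays in `D` and agrees with the positional strategy `σ` of player `b`. -/
structure PositionalPlay (G : ParityGame) (b : Bool) (D : Set G.V) (σ : G.V → G.V)
    (π : ℕ → G.V) : Prop where
  mem : ∀ i, π i ∈ D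
  edge : ∀ i, G.E (π i) (π (i + 1))
  agrees : ∀ i, G.Owns b (π i) → π (i + 1) = σ (π i)

/-- In the game restricted to `S`, the positional strategy `σ` of player `b` never leaves
`D` other than to `T`. -/
structure Confines (G : ParityGame) (b : Bool) (S D T : Set G.V) (σ : G.V → G.V) : Prop where
  own : ∀ v ∈ D, G.Owns b v → G.E v (σ v) ∧ σ v ∈ T
  other : ∀ v ∈ D, ¬ G.Owns b v → ∀ w ∈ S, G.E v w → w ∈ T

/-- In the game restricted to `S`, player `b` wins from all of `W` by a positional strategy
that never leaves `W`. -/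
def WinsOn (G : ParityGame) (b : Bool) (S W : Set G.V) : Prop :=
  W ⊆ S ∧ ∃ σ, G.Confines b S W W σ ∧
    ∀ π, G.PositionalPlay b W σ π → G.Objective b π

lemma owns_not_iff (b : Bool) (v : G.V) : G.Owns (!b) v ↔ ¬ G.Owns b v := by
  cases b <;> simp [Owns]

lemma satParity_shift (π : ℕ → G.V) (k : ℕ) :
    G.SatParity (fun i => π (i + k)) ↔ G.SatParity π := by
  have h : {p | ∀ N, ∃ i, N ≤ i ∧ G.c (π (i + k)) = p} =
      {p | ∀ N, ∃ i, N ≤ i ∧ G.c (π i) = p} := by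
    ext p
    constructor
    · intro h N
      obtain ⟨i, hi, hp⟩ := h N
      exact ⟨i + k, by omega, hp⟩
    · intro h N
      obtain ⟨i, hi, hp⟩ := h (N + k)
      exact ⟨i - k, by omega, by rwa [Nat.sub_add_cancel (by omega)]⟩
  simp only [SatParity, h]

lemma objective_shift (b : Bool) (π : ℕ → G.V) (k : ℕ) :
    G.Objective b (fun i => π (i + k)) ↔ G.Objective b π := by
  simp only [Objective, satParity_shift]

lemma satParity_iff_of_frequently {π : ℕ → G.V} {n : ℕ} (hle : ∀ i, G.c (π i) ≤ n)
    (hn : ∀ N, ∃ i, N ≤ i ∧ G.c (π i) = n) : G.SatParity π ↔ Even n := by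
  have h : IsGreatest {p | ∀ N, ∃ i, N ≤ i ∧ G.c (π i) = p} n := by
    refine ⟨hn, fun p hp => ?_⟩
    obtain ⟨i, -, rfl⟩ := hp 0
    exact hle i
  rw [SatParity, h.csSup_eq]

lemma winsOn_empty (b : Bool) (S : Set G.V) : G.WinsOn b S ∅ :=
  ⟨Set.empty_subset _, id, ⟨by simp, by simp⟩, fun _ h => (h.mem 0).elim⟩

/-- A winning region can be enlarged by a set `D` on which the player either wins while
staying in `D`, or enters the winning region. -/
lemma WinsOn.union {b : Bool} {S W D : Set G.V} {τ : G.V → G.V} (hW : G.WinsOn b S W)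
    (hDS : D ⊆ S) (hWD : Disjoint W D) (hτ : G.Confines b S D (W ∪ D) τ)
    (hwin : ∀ π, G.PositionalPlay b D τ π → G.Objective b π) : G.WinsOn b S (W ∪ D) := by
  classical
  obtain ⟨hWS, σ, hσ, hσwin⟩ := hW
  have hD : ∀ v ∈ D, v ∉ W := fun v hv hw => Set.disjoint_left.1 hWD hw hv
  refine ⟨Set.union_subset hWS hDS, fun v => if v ∈ W then σ v else τ v, ⟨?_, ?_⟩, ?_⟩
  · rintro v (hv | hv) ho
    · simpa [hv] using ⟨(hσ.own v hv ho).1, Or.inl (hσ.own v hv ho).2⟩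
    · simpa [hD v hv] using hτ.own v hv ho
  · rintro v (hv | hv) ho w hw he
    · exact Or.inl (hσ.other v hv ho w hw he)
    · exact hτ.other v hv ho w hw he
  · intro π hπ
    by_cases h : ∃ k, π k ∈ W
    · obtain ⟨k, hk⟩ := h
      have hstay : ∀ i, π (i + k) ∈ W := by
        intro i
        induction i with
        | zero => simpa using hk
        | succ i ih =>
          rw [Nat.add_right_comm]
          by_cases ho : G.Owns b (π (i + k))
          · rw [hπ.agrees _ ho, if_pos ih]
            exact (hσ.own _ ih ho).2
          · exact hσ.other _ ih ho _ (Set.union_subset hWS hDS (hπ.mem _)) (hπ.edge _)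
      rw [← objective_shift b π k]
      refine hσwin _ ⟨hstay, fun i => ?_, fun i ho => ?_⟩
      · simpa only [Nat.add_right_comm] using hπ.edge (i + k)
      · have := hπ.agrees (i + k) ho
        rw [if_pos (hstay i)] at this
        simpa only [Nat.add_right_comm] using this
    · push Not at h
      refine hwin π ⟨fun i => (hπ.mem i).resolve_left (h i), hπ.edge, fun i ho => ?_⟩
      simpa [h i] using hπ.agrees i ho

/-- A winning region can be enlarged by a vertex from which the player can force entering it. -/
lemma WinsOn.insert {b : Bool} {S W : Set G.V} {v w : G.V} (hW : G.WinsOn b S W)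
    (hvS : v ∈ S) (hvW : v ∉ W) (hown : G.Owns b v → G.E v w ∧ w ∈ W)
    (hother : ¬ G.Owns b v → ∀ u ∈ S, G.E v u → u ∈ W) : G.WinsOn b S (W ∪ {v}) := by
  refine hW.union (τ := fun _ => w) (by simpa using hvS) (by simpa using hvW) ⟨?_, ?_⟩ ?_
  · rintro _ rfl ho
    exact ⟨(hown ho).1, Or.inl (hown ho).2⟩
  · rintro _ rfl ho u hu he
    exact Or.inl (hother ho u hu he)
  · intro π hπ
    exfalso
    have h0 : π 0 = v := hπ.mem 0
    have h1 : π 1 = v := hπ.mem 1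
    have he := hπ.edge 0
    have ha := hπ.agrees 0
    simp only [zero_add, h0, h1] at he ha
    by_cases ho : G.Owns b v
    · exact hvW (ha ho ▸ (hown ho).2)
    · exact hvW (hother ho v hvS he)

/-- In the game restricted to `H`, player `b` can force a visit to `N` from all of `A`,
witnessed by a positional strategy that decreases a rank. -/
def Attracts (G : ParityGame) (b : Bool) (H N A : Set G.V) : Prop :=
  N ⊆ A ∧ A ⊆ H ∧ ∃ (σ : G.V → G.V) (r : G.V → ℕ), ∀ v ∈ A, v ∉ N →
    (G.Owns b v → G.E v (σ v) ∧ σ v ∈ A ∧ r (σ v) < r v) ∧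
    (¬ G.Owns b v → ∀ w ∈ H, G.E v w → w ∈ A ∧ r w < r v)

lemma attracts_self {b : Bool} {H N : Set G.V} (h : N ⊆ H) : G.Attracts b H N N :=
  ⟨subset_rfl, h, id, fun _ => 0, fun _ hv hn => (hn hv).elim⟩

lemma Attracts.insert {b : Bool} {H N A : Set G.V} {v w : G.V} (hA : G.Attracts b H N A)
    (hvH : v ∈ H) (hvA : v ∉ A) (hown : G.Owns b v → G.E v w ∧ w ∈ A)
    (hother : ¬ G.Owns b v → ∀ u ∈ H, G.E v u → u ∈ A) : G.Attracts b H N (A ∪ {v}) := by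
  classical
  obtain ⟨hNA, hAH, σ, r, hσ⟩ := hA
  have hne : ∀ u ∈ A, u ≠ v := fun u hu h => hvA (h ▸ hu)
  have hr : ∀ u, r u < ∑ x, r x + 1 := fun u =>
    Nat.lt_succ_of_le (Finset.single_le_sum (fun _ _ => Nat.zero_le _) (Finset.mem_univ u))
  refine ⟨hNA.trans Set.subset_union_left, Set.union_subset hAH (by simpa using hvH),
    Function.update σ v w, Function.update r v (∑ x, r x + 1), ?_⟩
  rintro u (hu | rfl) hN
  · obtain ⟨h1, h2⟩ := hσ u hu hN
    refine ⟨fun ho => ?_, fun ho x hx he => ?_⟩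
    · obtain ⟨he, hm, hlt⟩ := h1 ho
      rw [Function.update_of_ne (hne u hu), Function.update_of_ne (hne u hu),
        Function.update_of_ne (hne _ hm)]
      exact ⟨he, Or.inl hm, hlt⟩
    · obtain ⟨hm, hlt⟩ := h2 ho x hx he
      rw [Function.update_of_ne (hne u hu), Function.update_of_ne (hne _ hm)]
      exact ⟨Or.inl hm, hlt⟩
  · refine ⟨fun ho => ?_, fun ho x hx he => ?_⟩
    · obtain ⟨he, hm⟩ := hown ho
      rw [Function.update_self, Function.update_self, Function.update_of_ne (hne _ hm)]
      exact ⟨he, Or.inl hm, hr w⟩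
    · have hm := hother ho x hx he
      rw [Function.update_self, Function.update_of_ne (hne _ hm)]
      exact ⟨Or.inl hm, hr x⟩

/-- If player `b` favours the largest priority `n`, can attract to `n` from `A`, and wins
the subgame outside `A`, then player `b` wins everywhere on a set `H` that the opponent
cannot leave. -/
lemma winsOn_of_attracts {b : Bool} {n : ℕ} {S H A : Set G.V} (hHS : H ⊆ S)
    (hsucc : ∀ v ∈ H, ∃ w ∈ H, G.E v w)
    (htrap : ∀ v ∈ H, ¬ G.Owns b v → ∀ w ∈ S, G.E v w → w ∈ H)
    (hle : ∀ v ∈ H, G.c v ≤ n) (hb : b = true ↔ Even n)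
    (hA : G.Attracts b H {v ∈ H | G.c v = n} A)
    (hT : G.WinsOn b (H \ A) (H \ A)) : G.WinsOn b S H := by
  classical
  obtain ⟨hNA, hAH, σ, r, hσ⟩ := hA
  obtain ⟨-, τ, hτ, hτwin⟩ := hT
  choose! s hsH hsE using hsucc
  refine ⟨hHS, fun v => if v ∈ A then (if G.c v = n then s v else σ v) else τ v, ⟨?_, htrap⟩, ?_⟩
  · intro v hv ho
    by_cases hvA : v ∈ A
    · by_cases hn : G.c v = n
      · simpa [hvA, hn] using ⟨hsE v hv, hsH v hv⟩
      · obtain ⟨he, hm, -⟩ := (hσ v hvA fun h => hn h.2).1 ho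
        simpa [hvA, hn] using ⟨he, hAH hm⟩
    · simpa [hvA] using ⟨(hτ.own v ⟨hv, hvA⟩ ho).1, (hτ.own v ⟨hv, hvA⟩ ho).2.1⟩
  · intro π hπ
    by_cases hinf : ∀ N, ∃ i, N ≤ i ∧ G.c (π i) = n
    · rw [Objective, satParity_iff_of_frequently (fun i => hle _ (hπ.mem i)) hinf, hb]
    push Not at hinf
    obtain ⟨N, hN⟩ := hinf
    have hstep : ∀ i, N ≤ i → π i ∈ A → π (i + 1) ∈ A ∧ r (π (i + 1)) < r (π i) := by
      intro i hi hiA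
      obtain ⟨h1, h2⟩ := hσ _ hiA fun h => hN i hi h.2
      by_cases ho : G.Owns b (π i)
      · rw [hπ.agrees i ho, if_pos hiA, if_neg (hN i hi)]
        exact (h1 ho).2
      · exact h2 ho _ (hπ.mem _) (hπ.edge i)
    have hout : ∀ m i, N ≤ i → r (π i) = m → π i ∉ A := by
      intro m
      induction m using Nat.strong_induction_on with
      | _ m ih =>
        intro i hi hm hiA
        obtain ⟨hA', hlt⟩ := hstep i hi hiA
        exact ih _ (hm ▸ hlt) (i + 1) (by omega) rfl hA'
    have hnot : ∀ i, π (i + N) ∉ A := fun i => hout _ _ (by omega) rfl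
    rw [← objective_shift b π N]
    refine hτwin _ ⟨fun i => ⟨hπ.mem _, hnot i⟩, fun i => ?_, fun i ho => ?_⟩
    · simpa only [Nat.add_right_comm] using hπ.edge (i + N)
    · have := hπ.agrees (i + N) ho
      rw [if_neg (hnot i)] at this
      simpa only [Nat.add_right_comm] using this

/-- Positional determinacy of every subgame. -/
theorem exists_winsOn_partition (n : ℕ) : ∀ S : Set G.V, (∀ v ∈ S, ∃ w ∈ S, G.E v w) →
    (∀ v ∈ S, G.c v < n) → ∀ b, ∃ W, G.WinsOn b S W ∧ G.WinsOn (!b) S (S \ W) := by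
  induction n with
  | zero =>
    intro S _ hc b
    obtain rfl : S = ∅ := Set.eq_empty_of_forall_notMem fun v hv => absurd (hc v hv) (by omega)
    exact ⟨∅, winsOn_empty _ _, by simpa using winsOn_empty _ _⟩
  | succ n ih =>
    intro S hS hc
    suffices h : ∃ b, ∃ W, G.WinsOn (!b) S W ∧ G.WinsOn b S (S \ W) by
      obtain ⟨b, W, h1, h2⟩ := h
      intro a
      by_cases hab : a = b
      · subst hab
        exact ⟨S \ W, h2, by rwa [Set.sdiff_sdiff_cancel_left h1.1]⟩
      · obtain rfl : a = !b := by cases a <;> cases b <;> simp_all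
        exact ⟨W, h1, by simpa using h2⟩
    obtain ⟨b, hb⟩ : ∃ b : Bool, b = true ↔ Even n := ⟨decide (Even n), by simp⟩
    obtain ⟨W, hW, hWmax⟩ := (Set.toFinite {W | G.WinsOn (!b) S W}).exists_maximal
      ⟨∅, winsOn_empty _ _⟩
    have hno : ∀ v ∈ S \ W, ¬ G.WinsOn (!b) S (W ∪ {v}) := fun v hv h =>
      hv.2 (hWmax h Set.subset_union_left (Or.inr rfl))
    have htrap : ∀ v ∈ S \ W, ¬ G.Owns b v → ∀ w ∈ S, G.E v w → w ∈ S \ W := by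
      intro v hv ho w hw he
      refine ⟨hw, fun hwW => hno v hv ?_⟩
      exact WinsOn.insert hW hv.1 hv.2 (fun _ => ⟨he, hwW⟩)
        fun h => absurd ((owns_not_iff b v).2 ho) h
    have hsucc : ∀ v ∈ S \ W, ∃ w ∈ S \ W, G.E v w := by
      intro v hv
      by_contra! hcon
      have hin : ∀ u ∈ S, G.E v u → u ∈ W := fun u hu he => by
        by_contra hu'
        exact hcon u ⟨hu, hu'⟩ he
      obtain ⟨w, hw, he⟩ := hS v hv.1
      exact hno v hv (WinsOn.insert hW hv.1 hv.2 (fun _ => ⟨he, hin w hw he⟩) fun _ => hin)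
    obtain ⟨A, hA, hAmax⟩ :=
      (Set.toFinite {A | G.Attracts b (S \ W) {v ∈ S \ W | G.c v = n} A}).exists_maximal
        ⟨_, attracts_self (Set.sep_subset _ _)⟩
    have hnoA : ∀ v ∈ (S \ W) \ A,
        ¬ G.Attracts b (S \ W) {v ∈ S \ W | G.c v = n} (A ∪ {v}) := fun v hv h =>
      hv.2 (hAmax h Set.subset_union_left (Or.inr rfl))
    have htrapA : ∀ v ∈ (S \ W) \ A, G.Owns b v → ∀ w, G.E v w → w ∉ A :=
      fun v hv ho w he hwA =>
        hnoA v hv (Attracts.insert hA hv.1 hv.2 (fun _ => ⟨he, hwA⟩) fun h => absurd ho h)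
    have hsuccA : ∀ v ∈ (S \ W) \ A, ∃ w ∈ (S \ W) \ A, G.E v w := by
      intro v hv
      by_contra! hcon
      have hin : ∀ u ∈ S \ W, G.E v u → u ∈ A := fun u hu he => by
        by_contra hu'
        exact hcon u ⟨hu, hu'⟩ he
      obtain ⟨w, hw, he⟩ := hsucc v hv.1
      exact hnoA v hv (Attracts.insert hA hv.1 hv.2 (fun _ => ⟨he, hin w hw he⟩) fun _ => hin)
    have hle : ∀ v ∈ S \ W, G.c v ≤ n := fun v hv => Nat.le_of_lt_succ (hc v hv.1)
    obtain ⟨U, hU, hUb⟩ := ih ((S \ W) \ A) hsuccA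
      (fun v hv => lt_of_le_of_ne (hle v hv.1) fun h => hv.2 (hA.1 ⟨hv.1, h⟩)) (!b)
    have hUempty : U = ∅ := by
      obtain ⟨hUT, τ, hτ, hτwin⟩ := hU
      have hWU : G.WinsOn (!b) S (W ∪ U) := by
        refine WinsOn.union hW (fun v hv => (hUT hv).1.1)
          (Set.disjoint_left.2 fun v hw hv => (hUT hv).1.2 hw) ⟨?_, ?_⟩ hτwin
        · exact fun v hv ho => ⟨(hτ.own v hv ho).1, Or.inr (hτ.own v hv ho).2⟩
        · intro v hv ho w hw he
          by_cases hwW : w ∈ W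
          · exact Or.inl hwW
          · have hob : G.Owns b v := by
              by_contra h
              exact ho ((owns_not_iff b v).2 h)
            exact Or.inr (hτ.other v hv ho w ⟨⟨hw, hwW⟩, htrapA v (hUT hv) hob w he⟩ he)
      exact Set.eq_empty_of_forall_notMem fun v hv =>
        (hUT hv).1.2 (hWmax hWU Set.subset_union_left (Or.inr hv))
    subst hUempty
    rw [Bool.not_not, Set.sdiff_empty] at hUb
    exact ⟨b, W, hW, winsOn_of_attracts Set.sdiff_subset hsucc htrap hle hb hA hUb⟩

lemma WinsOn.objective_of_agrees {b : Bool} {W : Set G.V} {σ : G.V → G.V}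
    (hσ : G.Confines b Set.univ W W σ)
    (hwin : ∀ π, G.PositionalPlay b W σ π → G.Objective b π) {π : ℕ → G.V} (h0 : π 0 ∈ W)
    (hedge : ∀ i, G.E (π i) (π (i + 1)))
    (hagr : ∀ i, π i ∈ W → G.Owns b (π i) → π (i + 1) = σ (π i)) : G.Objective b π := by
  have hmem : ∀ i, π i ∈ W := by
    intro i
    induction i with
    | zero => exact h0
    | succ i hi =>
      by_cases ho : G.Owns b (π i)
      · exact hagr i hi ho ▸ (hσ.own _ hi ho).2
      · exact hσ.other _ hi ho _ (Set.mem_univ _) (hedge i)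
  exact hwin π ⟨hmem, hedge, fun i => hagr i (hmem i)⟩

lemma WinsOn.eveWinsFrom {W : Set G.V} (hW : G.WinsOn true Set.univ W) {v : G.V} (hv : v ∈ W) :
    G.EveWinsFrom v := by
  classical
  obtain ⟨-, σ, hσ, hwin⟩ := hW
  choose s hs using G.exists_succ
  refine ⟨⟨fun _ u => if u ∈ W then σ u else s u, fun _ u hu => ?_⟩, fun π hπ hcons => ?_⟩
  · by_cases h : u ∈ W
    · simpa [h] using (hσ.own u h (by simpa [Owns] using hu)).1
    · simpa [h] using hs u
  · refine (WinsOn.objective_of_agrees hσ hwin (hπ.1 ▸ hv) hπ.2 fun i hi ho => ?_).1 rfl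
    simpa [hi] using hcons i (ho.1 rfl)

lemma WinsOn.adamWinsFrom {W : Set G.V} (hW : G.WinsOn false Set.univ W) {v : G.V}
    (hv : v ∈ W) : G.AdamWinsFrom v := by
  classical
  obtain ⟨-, σ, hσ, hwin⟩ := hW
  choose s hs using G.exists_succ
  refine ⟨⟨fun _ u => if u ∈ W then σ u else s u, fun _ u hu => ?_⟩, fun π hπ hcons hsat => ?_⟩
  · by_cases h : u ∈ W
    · simpa [h] using (hσ.own u h (by simpa [Owns] using hu)).1
    · simpa [h] using hs u
  · have h := (WinsOn.objective_of_agrees hσ hwin (hπ.1 ▸ hv) hπ.2 fun i hi ho => ?_).2 hsat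
    · simp at h
    · simpa [hi] using hcons i (by simpa [Owns] using ho)

end ParityGame

/-- Parity games are determined: from every vertex, either Eve wins or Adam
wins. -/
theorem parity_determined (G : ParityGame) (hd : Even G.d) (v : G.V) :
    G.EveWinsFrom v ∨ G.AdamWinsFrom v := by
  obtain ⟨W, hE, hA⟩ := ParityGame.exists_winsOn_partition (G := G) (G.d + 1) Set.univ
    (fun v _ => (G.exists_succ v).imp fun _ h => ⟨Set.mem_univ _, h⟩)
    (fun v _ => Nat.lt_succ_of_le (G.c_le_d v)) true
  by_cases hv : v ∈ W
  · exact Or.inl (hE.eveWinsFrom hv)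
  · exact Or.inr (hA.adamWinsFrom ⟨Set.mem_univ v, hv⟩)
end

section
/- For all n, h ≥ 1 there exists an (n, h)-universal tree with at most 2^⌈log₂ n⌉ · C(⌈log₂ n⌉ + h − 1, ⌈log₂ n⌉) leaves, where C denotes the binomial coefficient and ⌈log₂ n⌉ the least integer k with n ≤ 2^k. -/
/-- Length of the longest common prefix of two lists. -/
def lcpLen : List ℕ → List ℕ → ℕ
  | a :: x, b :: y => if a = b then lcpLen x y + 1 else 0
  | _, _ => 0

/-- An ordered tree of height `h` with all leaves at depth exactly `h`, represented by its
(finite, nonempty) set of leaves: lists of child indices of length `h`. -/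
def IsTree (h : ℕ) (L : Finset (List ℕ)) : Prop :=
  L.Nonempty ∧ ∀ x ∈ L, x.length = h

/-- An embedding of the tree with leaf set `L'` into the tree with leaf set `L`:
an injective map, strictly monotone for the lexicographic order,
preserving lengths of longest common prefixes. -/
def TreeEmbeds (L' L : Finset (List ℕ)) : Prop :=
  ∃ f : List ℕ → List ℕ,
    (∀ x ∈ L', f x ∈ L) ∧
    (∀ x ∈ L', ∀ y ∈ L', f x = f y → x = y) ∧
    (∀ x ∈ L', ∀ y ∈ L', List.Lex (· < ·) x y → List.Lex (· < ·) (f x) (f y)) ∧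
    (∀ x ∈ L', ∀ y ∈ L', lcpLen (f x) (f y) = lcpLen x y)

/-- A tree is `(n, h)`-universal if every tree of height `h` with at most `n` leaves
embeds into it. -/
def UniversalTree (n h : ℕ) (T : Finset (List ℕ)) : Prop :=
  IsTree h T ∧ ∀ L : Finset (List ℕ), IsTree h L → L.card ≤ n → TreeEmbeds L T

theorem lcpLen_self (x : List ℕ) : lcpLen x x = x.length := by
  induction x with
  | nil => rfl
  | cons a x ih => simp [lcpLen, ih]

/-- Injectivity of an embedding follows from strict monotonicity. -/
theorem TreeEmbeds.of_strictMonoOn {L' L : Finset (List ℕ)} (f : List ℕ → List ℕ)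
    (hmem : ∀ x ∈ L', f x ∈ L) (hlt : ∀ x ∈ L', ∀ y ∈ L', x < y → f x < f y)
    (hlcp : ∀ x ∈ L', ∀ y ∈ L', lcpLen (f x) (f y) = lcpLen x y) : TreeEmbeds L' L := by
  refine ⟨f, hmem, fun x hx y hy hxy => ?_, hlt, hlcp⟩
  rcases lt_trichotomy x y with h | h | h
  · exact absurd (hlt x hx y hy h) (hxy ▸ lt_irrefl _)
  · exact h
  · exact absurd (hlt y hy x hx h) (hxy ▸ lt_irrefl _)

theorem exists_embeds_singleton (h : ℕ) :
    ∃ T : Finset (List ℕ), IsTree h T ∧ T.card = 1 ∧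
      ∀ L : Finset (List ℕ), (∀ x ∈ L, x.length = h) → L.card ≤ 1 → TreeEmbeds L T := by
  refine ⟨{List.replicate h 0}, ⟨by simp, by simp⟩, by simp, fun L hL hc => ?_⟩
  rw [Finset.card_le_one] at hc
  refine .of_strictMonoOn (fun _ => List.replicate h 0) (by simp) ?_ ?_
  · intro x hx y hy hxy
    exact absurd (hc x hx y hy) hxy.ne
  · intro x hx y hy
    rw [hc x hx y hy, lcpLen_self, lcpLen_self, hL y hy, List.length_replicate]

theorem exists_embeds_height_one (n : ℕ) (hn : 0 < n) :
    ∃ T : Finset (List ℕ), IsTree 1 T ∧ T.card ≤ n ∧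
      ∀ L : Finset (List ℕ), (∀ x ∈ L, x.length = 1) → L.card ≤ n → TreeEmbeds L T := by
  refine ⟨(Finset.range n).image (fun i => [i]), ⟨?_, by simp⟩, ?_, fun L hL hc => ?_⟩
  · exact ⟨[0], by simpa using hn⟩
  · exact Finset.card_image_le.trans (by simp)
  have hrank : ∀ x ∈ L, ∀ y, x < y →
      (L.filter (· < x)).card < (L.filter (· < y)).card := by
    intro x hx y hxy
    refine Finset.card_lt_card (Finset.ssubset_iff_subset_ne.2 ⟨fun z hz => ?_, fun he => ?_⟩)
    · simp only [Finset.mem_filter] at hz ⊢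
      exact ⟨hz.1, hz.2.trans hxy⟩
    · have : x ∈ L.filter (· < x) := he ▸ Finset.mem_filter.2 ⟨hx, hxy⟩
      simp at this
  refine .of_strictMonoOn (fun x => [(L.filter (· < x)).card]) (fun x hx => ?_) ?_ ?_
  · simp only [Finset.mem_image, Finset.mem_range]
    refine ⟨_, lt_of_lt_of_le (Finset.card_lt_card ?_) hc, rfl⟩
    exact Finset.filter_ssubset.2 ⟨x, hx, lt_irrefl x⟩
  · intro x hx y hy hxy
    rw [List.cons_lt_cons_iff]
    exact Or.inl (hrank x hx y hxy)
  · intro x hx y hy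
    rcases lt_trichotomy x y with h | h | h
    · have h1 := (hrank x hx y h).ne
      obtain ⟨a, rfl⟩ := List.length_eq_one_iff.1 (hL x hx)
      obtain ⟨b, rfl⟩ := List.length_eq_one_iff.1 (hL y hy)
      have h2 : a ≠ b := fun e => h.ne (by rw [e])
      simp only [lcpLen, if_neg h1, if_neg h2]
    · subst h
      simp [lcpLen_self, hL x hx]
    · have h1 := (hrank y hy x h).ne'
      obtain ⟨a, rfl⟩ := List.length_eq_one_iff.1 (hL x hx)
      obtain ⟨b, rfl⟩ := List.length_eq_one_iff.1 (hL y hy)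
      have h2 : a ≠ b := fun e => h.ne (by rw [e])
      simp only [lcpLen, if_neg h1, if_neg h2]

/-- Some child `p` of the root splits the leaves so that at most half of them lie strictly to
its left, and at most half strictly to its right. -/
theorem exists_median_head (L : Finset (List ℕ)) (m : ℕ) (hc : L.card ≤ 2 * m) :
    ∃ p, (L.filter (fun x => x.headD 0 < p)).card ≤ m ∧
      (L.filter (fun x => p < x.headD 0)).card ≤ m := by
  classical
  have hex : ∃ p, (L.filter (fun x => p < x.headD 0)).card ≤ m := by
    refine ⟨L.sup (fun x => x.headD 0), ?_⟩
    rw [Finset.filter_false_of_mem]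
    · simp
    · intro x hx
      exact not_lt.2 (Finset.le_sup (f := fun x : List ℕ => x.headD 0) hx)
  refine ⟨Nat.find hex, ?_, Nat.find_spec hex⟩
  rcases hp : Nat.find hex with _ | q
  · simp
  · have hq := Nat.find_min hex (m := q) (by omega)
    have hsum := Finset.card_filter_add_card_filter_not (s := L) (fun x => q < x.headD 0)
    have heq : L.filter (fun x => x.headD 0 < q + 1) = L.filter (fun x => ¬ q < x.headD 0) :=
      Finset.filter_congr fun x _ => by omega
    rw [heq]
    omega

/-- Add `c` to the first entry of a list. -/
def shiftHead (c : ℕ) : List ℕ → List ℕ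
  | [] => []
  | a :: x => (c + a) :: x

/-- The tree whose root has, from left to right, the children of `S`, one child carrying `M`,
and the children of `S` again. -/
def sandwich (A : ℕ) (S M : Finset (List ℕ)) : Finset (List ℕ) :=
  S ∪ (M.image (List.cons A) ∪ S.image (shiftHead (A + 1)))

theorem card_sandwich_le (A : ℕ) (S M : Finset (List ℕ)) :
    (sandwich A S M).card ≤ 2 * S.card + M.card := by
  have h1 := Finset.card_union_le S (M.image (List.cons A) ∪ S.image (shiftHead (A + 1)))
  have h2 := Finset.card_union_le (M.image (List.cons A)) (S.image (shiftHead (A + 1)))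
  have h3 := Finset.card_image_le (s := M) (f := List.cons A)
  have h4 := Finset.card_image_le (s := S) (f := shiftHead (A + 1))
  rw [sandwich]
  omega

theorem IsTree.sandwich {h A : ℕ} {S M : Finset (List ℕ)} (hS : IsTree (h + 1) S)
    (hM : IsTree h M) : IsTree (h + 1) (sandwich A S M) := by
  refine ⟨hS.1.mono Finset.subset_union_left, fun x hx => ?_⟩
  simp only [_root_.sandwich, Finset.mem_union, Finset.mem_image] at hx
  rcases hx with hx | ⟨y, hy, rfl⟩ | ⟨y, hy, rfl⟩
  · exact hS.2 x hx
  · simp [hM.2 y hy]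
  · have := hS.2 y hy
    cases y <;> simp_all [shiftHead]

theorem embeds_sandwich {h m A : ℕ} {S M : Finset (List ℕ)} (hS : IsTree (h + 1) S)
    (hA : ∀ x ∈ S, x.headD 0 < A)
    (hSu : ∀ L : Finset (List ℕ), (∀ x ∈ L, x.length = h + 1) → L.card ≤ m → TreeEmbeds L S)
    (hMu : ∀ L : Finset (List ℕ), (∀ x ∈ L, x.length = h) → L.card ≤ 2 * m → TreeEmbeds L M)
    (L : Finset (List ℕ)) (hL : ∀ x ∈ L, x.length = h + 1) (hc : L.card ≤ 2 * m) :
    TreeEmbeds L (sandwich A S M) := by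
  obtain ⟨p, hleft, hright⟩ := exists_median_head L m hc
  obtain ⟨f, hf, -, hflt, hflcp⟩ := hSu _ (fun x hx => hL x (Finset.mem_filter.1 hx).1) hleft
  obtain ⟨g, hg, -, hglt, hglcp⟩ := hSu _ (fun x hx => hL x (Finset.mem_filter.1 hx).1) hright
  obtain ⟨e, he, -, helt, helcp⟩ :=
    hMu ((L.filter (fun x => x.headD 0 = p)).image List.tail)
      (fun x hx => by
        obtain ⟨y, hy, rfl⟩ := Finset.mem_image.1 hx
        simp [hL y (Finset.mem_filter.1 hy).1])
      ((Finset.card_image_le.trans (Finset.card_filter_le _ _)).trans hc)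
  have hcons : ∀ x ∈ S, ∃ a s, x = a :: s ∧ a < A := by
    intro x hx
    have h1 := hS.2 x hx
    have h2 := hA x hx
    cases x with
    | nil => simp at h1
    | cons a s => exact ⟨a, s, rfl, h2⟩
  let F : List ℕ → List ℕ := fun x =>
    if x.headD 0 < p then f x else if x.headD 0 = p then A :: e x.tail
    else shiftHead (A + 1) (g x)
  have hFl : ∀ a s, a < p → F (a :: s) = f (a :: s) := fun a s ha => by simp [F, ha]
  have hFm : ∀ s, F (p :: s) = A :: e s := fun s => by simp [F]
  have hFr : ∀ a s, p < a → F (a :: s) = shiftHead (A + 1) (g (a :: s)) := fun a s ha => by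
    simp [F, ha.not_gt, ha.ne']
  have ml : ∀ a s, a :: s ∈ L → a < p → a :: s ∈ L.filter (fun x => x.headD 0 < p) :=
    fun a s hx ha => Finset.mem_filter.2 ⟨hx, ha⟩
  have mr : ∀ a s, a :: s ∈ L → p < a → a :: s ∈ L.filter (fun x => p < x.headD 0) :=
    fun a s hx ha => Finset.mem_filter.2 ⟨hx, ha⟩
  have mm : ∀ s, p :: s ∈ L → s ∈ (L.filter (fun x => x.headD 0 = p)).image List.tail :=
    fun s hx => Finset.mem_image.2 ⟨p :: s, Finset.mem_filter.2 ⟨hx, rfl⟩, rfl⟩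
  have hpair : ∀ x ∈ L, ∀ y ∈ L,
      (x < y → F x < F y) ∧ lcpLen (F x) (F y) = lcpLen x y := by
    intro x hx y hy
    obtain ⟨a, s, rfl⟩ := List.exists_cons_of_length_eq_add_one (hL x hx)
    obtain ⟨b, t, rfl⟩ := List.exists_cons_of_length_eq_add_one (hL y hy)
    rcases lt_trichotomy a p with ha | ha | ha <;> rcases lt_trichotomy b p with hb | hb | hb
    · rw [hFl a s ha, hFl b t hb]
      exact ⟨hflt _ (ml a s hx ha) _ (ml b t hy hb), hflcp _ (ml a s hx ha) _ (ml b t hy hb)⟩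
    · obtain ⟨a', s', h1, ha'⟩ := hcons _ (hf _ (ml a s hx ha))
      subst hb
      rw [hFl a s ha, hFm t, h1]
      simp [lcpLen, List.cons_lt_cons_iff, ha', ha'.ne, ha.ne]
    · obtain ⟨a', s', h1, ha'⟩ := hcons _ (hf _ (ml a s hx ha))
      obtain ⟨b', t', h2, hb'⟩ := hcons _ (hg _ (mr b t hy hb))
      rw [hFl a s ha, hFr b t hb, h1, h2]
      have h3 : a' < A + 1 + b' := by omega
      simp [lcpLen, shiftHead, List.cons_lt_cons_iff, h3, h3.ne, (ha.trans hb).ne]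
    · obtain ⟨b', t', h2, hb'⟩ := hcons _ (hf _ (ml b t hy hb))
      subst ha
      rw [hFm s, hFl b t hb, h2]
      simp [lcpLen, List.cons_lt_cons_iff, hb.not_gt, hb.ne', hb'.ne']
    · subst ha
      subst hb
      rw [hFm s, hFm t]
      have h1 : s < t → e s < e t := helt s (mm s hx) t (mm t hy)
      simpa [lcpLen, List.cons_lt_cons_iff, helcp s (mm s hx) t (mm t hy)] using h1
    · obtain ⟨b', t', h2, hb'⟩ := hcons _ (hg _ (mr b t hy hb))
      subst ha
      rw [hFm s, hFr b t hb, h2]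
      have h3 : A < A + 1 + b' := by omega
      simp [lcpLen, shiftHead, List.cons_lt_cons_iff, h3, h3.ne, hb.ne]
    · obtain ⟨a', s', h1, ha'⟩ := hcons _ (hg _ (mr a s hx ha))
      obtain ⟨b', t', h2, hb'⟩ := hcons _ (hf _ (ml b t hy hb))
      rw [hFr a s ha, hFl b t hb, h1, h2]
      have h3 : b' < A + 1 + a' := by omega
      have h4 := hb.trans ha
      simp [lcpLen, shiftHead, List.cons_lt_cons_iff, h3.ne', h4.ne', h4.not_gt]
    · obtain ⟨a', s', h1, ha'⟩ := hcons _ (hg _ (mr a s hx ha))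
      subst hb
      rw [hFr a s ha, hFm t, h1]
      have h3 : A < A + 1 + a' := by omega
      simp [lcpLen, shiftHead, List.cons_lt_cons_iff, h3.ne', ha.ne', ha.not_gt]
    · obtain ⟨a', s', h1, ha'⟩ := hcons _ (hg _ (mr a s hx ha))
      obtain ⟨b', t', h2, hb'⟩ := hcons _ (hg _ (mr b t hy hb))
      have hlt : a :: s < b :: t → g (a :: s) < g (b :: t) :=
        hglt _ (mr a s hx ha) _ (mr b t hy hb)
      have hlcp := hglcp _ (mr a s hx ha) _ (mr b t hy hb)
      rw [hFr a s ha, hFr b t hb]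
      rw [h1, h2] at hlt hlcp ⊢
      rw [← hlcp]
      refine ⟨fun hxy => ?_, by simp [lcpLen, shiftHead]⟩
      simpa [shiftHead, List.cons_lt_cons_iff] using hlt hxy
  refine .of_strictMonoOn F (fun x hx => ?_) (fun x hx y hy => (hpair x hx y hy).1)
    (fun x hx y hy => (hpair x hx y hy).2)
  obtain ⟨a, s, rfl⟩ := List.exists_cons_of_length_eq_add_one (hL x hx)
  simp only [sandwich, Finset.mem_union, Finset.mem_image]
  rcases lt_trichotomy a p with ha | rfl | ha
  · exact Or.inl (hFl a s ha ▸ hf _ (ml a s hx ha))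
  · exact Or.inr (Or.inl ⟨_, he _ (mm s hx), (hFm s).symm⟩)
  · exact Or.inr (Or.inr ⟨_, hg _ (mr a s hx ha), (hFr a s ha).symm⟩)

theorem exists_universalTree_two_pow (k h : ℕ) :
    ∃ T : Finset (List ℕ), IsTree (h + 1) T ∧ T.card ≤ 2 ^ k * (k + h).choose k ∧
      ∀ L : Finset (List ℕ), (∀ x ∈ L, x.length = h + 1) → L.card ≤ 2 ^ k →
        TreeEmbeds L T := by
  induction k generalizing h with
  | zero =>
    obtain ⟨T, hT, hcard, hu⟩ := exists_embeds_singleton (h + 1)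
    exact ⟨T, hT, by simp [hcard], by simpa using hu⟩
  | succ k ihk =>
    induction h with
    | zero => simpa using exists_embeds_height_one (2 ^ (k + 1)) (by positivity)
    | succ h ihh =>
      obtain ⟨S, hS, hScard, hSu⟩ := ihk (h + 1)
      obtain ⟨M, hM, hMcard, hMu⟩ := ihh
      have hA : ∀ x ∈ S, x.headD 0 < S.sup (fun x => x.headD 0) + 1 := fun x hx =>
        Nat.lt_succ_of_le (Finset.le_sup (f := fun x : List ℕ => x.headD 0) hx)
      rw [pow_succ'] at hMu ⊢
      refine ⟨sandwich _ S M, hS.sandwich hM, ?_, embeds_sandwich hS hA hSu hMu⟩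
      refine (card_sandwich_le _ S M).trans ?_
      have hch : (k + 1 + (h + 1)).choose (k + 1) =
          (k + (h + 1)).choose k + (k + 1 + h).choose (k + 1) := by
        rw [show k + 1 + (h + 1) = (k + (h + 1)) + 1 by ring, Nat.choose_succ_succ,
          show k + 1 + h = k + (h + 1) by ring]
      rw [hch]
      rw [pow_succ'] at hMcard
      nlinarith

/-- For all `n, h ≥ 1` there exists an `(n, h)`-universal tree with at most
`2 ^ ⌈log₂ n⌉ * C(⌈log₂ n⌉ + h − 1, ⌈log₂ n⌉)` leaves. -/
theorem exists_small_universalTree (n h : ℕ) (hn : 1 ≤ n) (hh : 1 ≤ h) :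
    ∃ T : Finset (List ℕ), UniversalTree n h T ∧
      T.card ≤ 2 ^ Nat.clog 2 n * Nat.choose (Nat.clog 2 n + h - 1) (Nat.clog 2 n) := by
  obtain ⟨h, rfl⟩ := Nat.exists_eq_add_of_le' hh
  obtain ⟨T, hT, hcard, hu⟩ := exists_universalTree_two_pow (Nat.clog 2 n) h
  exact ⟨T, ⟨hT, fun L hL hc => hu L hL.2 (hc.trans (Nat.le_pow_clog one_lt_two n))⟩, hcard⟩
end

section
/- For all n, h ≥ 1, every (n, h)-universal tree has at least C(⌊log₂ n⌋ + h − 1, ⌊log₂ n⌋) leaves, where ⌊log₂ n⌋ is the greatest integer k with 2^k ≤ n and C denotes the binomial coefficient; in particular the size of any (n, h)-universal tree is at least quasipolynomial in n and h. -/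
theorem lcpLen_self_s16 (a : List ℕ) : lcpLen a a = a.length := by
  induction a with
  | nil => rfl
  | cons c a ih => simp [lcpLen, ih]

theorem lcpLen_lt_length {a b : List ℕ} (hab : a.length = b.length) (hne : a ≠ b) :
    lcpLen a b < a.length := by
  induction a generalizing b with
  | nil => cases b <;> simp_all
  | cons c a ih =>
    cases b with
    | nil => simp at hab
    | cons d b =>
      by_cases hcd : c = d
      · subst hcd
        simpa [lcpLen] using ih (by simpa using hab) (by simpa using hne)
      · simp [lcpLen, hcd]

theorem lcpLen_append_of_ne {a b : List ℕ} (hab : a.length = b.length) (hne : a ≠ b)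
    (s t : List ℕ) : lcpLen (a ++ s) (b ++ t) = lcpLen a b := by
  induction a generalizing b with
  | nil => cases b <;> simp_all
  | cons c a ih =>
    cases b with
    | nil => simp at hab
    | cons d b =>
      by_cases hcd : c = d
      · subst hcd
        simpa [lcpLen] using ih (by simpa using hab) (by simpa using hne)
      · simp [lcpLen, hcd]

theorem length_le_lcpLen_append (a s t : List ℕ) : a.length ≤ lcpLen (a ++ s) (a ++ t) := by
  induction a with
  | nil => simp
  | cons c a ih => simpa [lcpLen] using ih

theorem lex_append_iff_of_ne {a b : List ℕ} (hab : a.length = b.length) (hne : a ≠ b)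
    (s t : List ℕ) : List.Lex (· < ·) (a ++ s) (b ++ t) ↔ List.Lex (· < ·) a b := by
  induction a generalizing b with
  | nil => cases b <;> simp_all
  | cons c a ih =>
    cases b with
    | nil => simp at hab
    | cons d b =>
      by_cases hcd : c = d
      · subst hcd
        simpa [List.lex_cons_iff] using ih (by simpa using hab) (by simpa using hne)
      · simp only [List.cons_append]
        constructor
        · rintro (_ | h | h)
          · exact .rel ‹_›
          · exact absurd rfl hcd
        · rintro (_ | h | h)
          · exact .rel ‹_›
          · exact absurd rfl hcd

/-- Two leaves of height `h + 1` have the same parent iff their longest common prefix has length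
at least `h`. -/
theorem dropLast_eq_iff_le_lcpLen {h : ℕ} {u v : List ℕ} (hu : u.length = h + 1)
    (hv : v.length = h + 1) : u.dropLast = v.dropLast ↔ h ≤ lcpLen u v := by
  obtain ⟨a, i, rfl⟩ := List.eq_nil_or_concat' u |>.resolve_left (by rintro rfl; simp at hu)
  obtain ⟨b, j, rfl⟩ := List.eq_nil_or_concat' v |>.resolve_left (by rintro rfl; simp at hv)
  simp only [List.length_append, List.length_singleton, Nat.add_right_cancel_iff] at hu hv
  simp only [List.dropLast_concat]
  constructor
  · rintro rfl
    exact hu ▸ length_le_lcpLen_append a _ _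
  · intro hle
    by_contra hne
    rw [lcpLen_append_of_ne (hu.trans hv.symm) hne] at hle
    have := lcpLen_lt_length (hu.trans hv.symm) hne
    omega

theorem lcpLen_dropLast {h : ℕ} {u v : List ℕ} (hu : u.length = h + 1)
    (hv : v.length = h + 1) (hne : u.dropLast ≠ v.dropLast) :
    lcpLen u.dropLast v.dropLast = lcpLen u v := by
  obtain ⟨a, i, rfl⟩ := List.eq_nil_or_concat' u |>.resolve_left (by rintro rfl; simp at hu)
  obtain ⟨b, j, rfl⟩ := List.eq_nil_or_concat' v |>.resolve_left (by rintro rfl; simp at hv)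
  simp only [List.length_append, List.length_singleton, Nat.add_right_cancel_iff] at hu hv
  simp only [List.dropLast_concat] at hne ⊢
  exact (lcpLen_append_of_ne (hu.trans hv.symm) hne _ _).symm

theorem lex_dropLast_iff {h : ℕ} {u v : List ℕ} (hu : u.length = h + 1)
    (hv : v.length = h + 1) (hne : u.dropLast ≠ v.dropLast) :
    List.Lex (· < ·) u.dropLast v.dropLast ↔ List.Lex (· < ·) u v := by
  obtain ⟨a, i, rfl⟩ := List.eq_nil_or_concat' u |>.resolve_left (by rintro rfl; simp at hu)
  obtain ⟨b, j, rfl⟩ := List.eq_nil_or_concat' v |>.resolve_left (by rintro rfl; simp at hv)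
  simp only [List.length_append, List.length_singleton, Nat.add_right_cancel_iff] at hu hv
  simp only [List.dropLast_concat] at hne ⊢
  exact (lex_append_iff_of_ne (hu.trans hv.symm) hne _ _).symm

/-- The leaves of `T` whose parent is `y`. -/
def leafChildren (T : Finset (List ℕ)) (y : List ℕ) : Finset (List ℕ) :=
  T.filter fun x => x.dropLast = y

/-- The parents of leaves of `T` having at least `d` children. -/
def parentsOfDegree (d : ℕ) (T : Finset (List ℕ)) : Finset (List ℕ) :=
  (T.image List.dropLast).filter fun y => d ≤ (leafChildren T y).card

/-- The tree obtained from `L` by giving `d` children to every leaf. -/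
def addLeafChildren (d : ℕ) (L : Finset (List ℕ)) : Finset (List ℕ) :=
  (L ×ˢ Finset.range d).image fun p => p.1 ++ [p.2]

theorem mem_addLeafChildren {d : ℕ} {L : Finset (List ℕ)} {x : List ℕ} {i : ℕ} (hx : x ∈ L)
    (hi : i < d) : x ++ [i] ∈ addLeafChildren d L :=
  Finset.mem_image.2 ⟨(x, i), by simp [hx, hi], rfl⟩

theorem IsTree.addLeafChildren {h d : ℕ} {L : Finset (List ℕ)} (hL : IsTree h L) (hd : 1 ≤ d) :
    IsTree (h + 1) (addLeafChildren d L) := by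
  obtain ⟨⟨x, hx⟩, hlen⟩ := hL
  refine ⟨⟨_, mem_addLeafChildren hx hd⟩, fun y hy => ?_⟩
  obtain ⟨p, hp, rfl⟩ := Finset.mem_image.1 hy
  simp [hlen p.1 (Finset.mem_product.1 hp).1]

theorem card_addLeafChildren_le (d : ℕ) (L : Finset (List ℕ)) :
    (addLeafChildren d L).card ≤ L.card * d :=
  Finset.card_image_le.trans (by simp)

theorem TreeEmbeds.parentsOfDegree {h d : ℕ} {L T : Finset (List ℕ)} (hL : IsTree h L)
    (hT : IsTree (h + 1) T) (hd : 1 ≤ d) (hf : TreeEmbeds (addLeafChildren d L) T) :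
    TreeEmbeds L (parentsOfDegree d T) := by
  obtain ⟨f, hmem, hinj, hlex, hlcp⟩ := hf
  have hlen {x i} (hx : x ∈ L) (hi : i < d) : (f (x ++ [i])).length = h + 1 :=
    hT.2 _ (hmem _ (mem_addLeafChildren hx hi))
  have hdrop {x y i j} (hx : x ∈ L) (hy : y ∈ L) (hi : i < d) (hj : j < d) :
      (f (x ++ [i])).dropLast = (f (y ++ [j])).dropLast ↔ x = y := by
    rw [dropLast_eq_iff_le_lcpLen (hlen hx hi) (hlen hy hj),
      hlcp _ (mem_addLeafChildren hx hi) _ (mem_addLeafChildren hy hj),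
      ← dropLast_eq_iff_le_lcpLen (by simp [hL.2 x hx]) (by simp [hL.2 y hy])]
    simp
  refine ⟨fun x => (f (x ++ [0])).dropLast, fun x hx => ?_, fun x hx y hy hxy => ?_,
    fun x hx y hy hxy => ?_, fun x hx y hy => ?_⟩
  · refine Finset.mem_filter.2
      ⟨Finset.mem_image_of_mem _ (hmem _ (mem_addLeafChildren hx hd)), ?_⟩
    have hcard := Finset.card_le_card_of_injOn (s := Finset.range d)
      (t := leafChildren T (f (x ++ [0])).dropLast) (fun i => f (x ++ [i]))
      (fun i hi => by
        have hi : i < d := by simpa using hi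
        simpa [leafChildren] using
          ⟨hmem _ (mem_addLeafChildren hx hi), (hdrop hx hx hi hd).2 rfl⟩)
      (fun i hi j hj hij => by
        have hi : i < d := by simpa using hi
        have hj : j < d := by simpa using hj
        simpa using hinj _ (mem_addLeafChildren hx hi) _ (mem_addLeafChildren hx hj) hij)
    simpa using hcard
  · exact (hdrop hx hy hd hd).1 hxy
  · have hne : x ≠ y := by
      rintro rfl
      exact List.lex_irrefl (lt_irrefl (α := ℕ)) x hxy
    rw [lex_dropLast_iff (hlen hx hd) (hlen hy hd) ((hdrop hx hy hd hd).not.2 hne)]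
    refine hlex _ (mem_addLeafChildren hx hd) _ (mem_addLeafChildren hy hd) ?_
    rwa [lex_append_iff_of_ne ((hL.2 x hx).trans (hL.2 y hy).symm) hne]
  · by_cases hxy : x = y
    · subst hxy
      simp [lcpLen_self_s16, hlen hx hd, hL.2 x hx]
    · rw [lcpLen_dropLast (hlen hx hd) (hlen hy hd) ((hdrop hx hy hd hd).not.2 hxy),
        hlcp _ (mem_addLeafChildren hx hd) _ (mem_addLeafChildren hy hd),
        lcpLen_append_of_ne ((hL.2 x hx).trans (hL.2 y hy).symm) hxy]

theorem UniversalTree.parentsOfDegree {m d n h : ℕ} {T : Finset (List ℕ)}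
    (hT : UniversalTree n (h + 1) T) (hm : 1 ≤ m) (hd : 1 ≤ d) (hn : m * d ≤ n) :
    UniversalTree m h (parentsOfDegree d T) := by
  have hembed (L : Finset (List ℕ)) (hL : IsTree h L) (hcard : L.card ≤ m) :
      TreeEmbeds L (_root_.parentsOfDegree d T) :=
    (hT.2 _ (hL.addLeafChildren hd) ((card_addLeafChildren_le d L).trans
      ((Nat.mul_le_mul_right d hcard).trans hn))).parentsOfDegree hL hT.1 hd
  refine ⟨⟨?_, fun y hy => ?_⟩, hembed⟩
  · obtain ⟨f, hf, -⟩ := hembed {List.replicate h 0} ⟨by simp, by simp⟩ (by simpa using hm)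
    exact ⟨_, hf _ (Finset.mem_singleton_self _)⟩
  · obtain ⟨x, hx, rfl⟩ := Finset.mem_image.1 (Finset.mem_filter.1 hy).1
    simp [hT.1.2 x hx]

theorem sum_card_parentsOfDegree_two_pow_le (k : ℕ) (T : Finset (List ℕ)) :
    ∑ i ∈ Finset.range k, (parentsOfDegree (2 ^ i) T).card ≤ T.card := by
  rw [Finset.card_eq_sum_card_image List.dropLast T]
  simp only [parentsOfDegree, Finset.card_filter _ (T.image List.dropLast)]
  rw [Finset.sum_comm]
  refine Finset.sum_le_sum fun y _ => ?_
  rw [← Finset.card_filter]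
  refine (Finset.card_le_card (t := Finset.range (leafChildren T y).card) fun i hi => ?_).trans
    (by simp [leafChildren])
  exact Finset.mem_range.2 (Nat.lt_two_pow_self.trans_le (Finset.mem_filter.1 hi).2)

theorem UniversalTree.choose_le_card {k h : ℕ} {T : Finset (List ℕ)}
    (hT : UniversalTree (2 ^ k) (h + 1) T) : (k + h).choose h ≤ T.card := by
  induction h generalizing k T with
  | zero => simpa [Finset.one_le_card] using hT.1.1
  | succ h ih =>
    rw [← add_assoc, ← Nat.sum_range_add_choose, ← Finset.sum_range_reflect]
    refine (Finset.sum_le_sum fun i hi => ?_).trans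
      (sum_card_parentsOfDegree_two_pow_le (k + 1) T)
    have hi : i ≤ k := Nat.lt_succ_iff.1 (Finset.mem_range.1 hi)
    exact ih (hT.parentsOfDegree Nat.one_le_two_pow Nat.one_le_two_pow (by
      rw [← pow_add]; exact Nat.pow_le_pow_right two_pos (by omega)))

/-- For all `n, h ≥ 1`, every `(n, h)`-universal tree has at least
`C(⌊log₂ n⌋ + h − 1, ⌊log₂ n⌋)` leaves (a quasipolynomial lower bound). -/
theorem universalTree_quasipolynomial_lower_bound (n h : ℕ) (hn : 1 ≤ n) (hh : 1 ≤ h)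
    (T : Finset (List ℕ)) (hT : UniversalTree n h T) :
    Nat.choose (Nat.log 2 n + h - 1) (Nat.log 2 n) ≤ T.card := by
  obtain ⟨m, rfl⟩ := Nat.exists_eq_add_of_le' hh
  have hpow : UniversalTree (2 ^ Nat.log 2 n) (m + 1) T :=
    ⟨hT.1, fun L hL hcard => hT.2 L hL (hcard.trans (Nat.pow_log_le_self 2 (by omega)))⟩
  rw [← add_assoc, Nat.add_sub_cancel, Nat.choose_symm_add]
  exact hpow.choose_le_card
end
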